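/- Let q = 2^r with r ≥ 3 an integer. Set N₁ = |SO⁺(2,q)| = q−1, and for 0 ≤ j ≤ N₁ let C_{1,j} denote the number of codewords of Hamming weight j in the binary code C(SO⁺(2,q)). Then for every integer h ≥ 1, the identity MK^h = Σ_{l=0}^{h−1} (−1)^{h+l+1} binom(h,l) (q−1)^{h−l} MK^l + q · Σ_{j=0}^{min(N₁,h)} (−1)^{h+j} C_{1,j} Σ_{t=j}^{h} t! S(h,t) 2^{h−t} binom(N₁−j, N₁−t) holds (an identity of integers). -/

import Mathlib

open Finset Matrix

/-- The quadratic form `θ⁺(x) = ∑ i, x_i x_{n+i}` on `F^{2n}` (columns indexed by `Fin n ⊕ Fin n`). -/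
def thetaPlus (F : Type) [Field F] (n : ℕ) (x : Fin n ⊕ Fin n → F) : F :=
  ∑ i : Fin n, x (Sum.inl i) * x (Sum.inr i)

/-- The orthogonal group `O⁺(2n,q)`: invertible matrices preserving `θ⁺`. -/
noncomputable def OplusGrp (F : Type) [Field F] [Fintype F] [DecidableEq F] (n : ℕ) :
    Finset (Matrix (Fin n ⊕ Fin n) (Fin n ⊕ Fin n) F) := by
  classical
  exact Finset.univ.filter (fun w => IsUnit w ∧
    ∀ x : Fin n ⊕ Fin n → F, thetaPlus F n (w.mulVec x) = thetaPlus F n x)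

/-- `SO⁺(2n,q)`: the kernel of `δ⁺(w) = Tr(B ᵗC)` on `O⁺(2n,q)`,
where `w = [[A,B],[C,D]]` in `n × n` blocks. -/
noncomputable def SOplusGrp (F : Type) [Field F] [Fintype F] [DecidableEq F] (n : ℕ) :
    Finset (Matrix (Fin n ⊕ Fin n) (Fin n ⊕ Fin n) F) := by
  classical
  exact (OplusGrp F n).filter
    (fun w => Matrix.trace (Matrix.toBlocks₁₂ w * (Matrix.toBlocks₂₁ w)ᵀ) = 0)

/-- The trace map `tr(x) = x + x² + ⋯ + x^{2^{r−1}}`, valued in `𝔽₂ = {0,1} ⊆ F`. -/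
def trF (F : Type) [Field F] (r : ℕ) (x : F) : F := ∑ i ∈ Finset.range r, x ^ 2 ^ i

/-- The canonical additive character `λ(x) = (−1)^{tr(x)} ∈ {±1} ⊆ ℤ`. -/
noncomputable def lam (F : Type) [Field F] (r : ℕ) (x : F) : ℤ := by
  classical exact if trF F r x = 0 then 1 else -1

/-- The trace map `tr` viewed as a function into `𝔽₂ = ZMod 2`. -/
noncomputable def tr2 (F : Type) [Field F] (r : ℕ) (x : F) : ZMod 2 := by
  classical exact if trF F r x = 0 then 0 else 1

/-- The Kloosterman sum `K(λ;a) = ∑_{α ∈ F*} λ(α + aα⁻¹)`. -/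
noncomputable def Kl (F : Type) [Field F] [Fintype F] (r : ℕ) (a : F) : ℤ := by
  classical
  exact ∑ α ∈ Finset.univ.filter (fun α : F => α ≠ 0), lam F r (α + a * α⁻¹)

/-- The `m`-dimensional Kloosterman sum
`K_m(λ;a) = ∑_{α₁,…,α_m ∈ F*} λ(α₁ + ⋯ + α_m + aα₁⁻¹⋯α_m⁻¹)`;
for `m = 0` this is `K₀(λ;a) = λ(a)`. -/
noncomputable def Klm (F : Type) [Field F] [Fintype F] (r m : ℕ) (a : F) : ℤ := by
  classical
  exact ∑ v ∈ Finset.univ.filter (fun v : Fin m → F => ∀ i, v i ≠ 0),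
    lam F r ((∑ i, v i) + a * (∏ i, v i)⁻¹)

/-- The power moment `MK^h = ∑_{a ∈ F*} K(λ;a)^h`. -/
noncomputable def MK (F : Type) [Field F] [Fintype F] (r h : ℕ) : ℤ := by
  classical exact ∑ a ∈ Finset.univ.filter (fun a : F => a ≠ 0), (Kl F r a) ^ h

/-- The power moment `MK₂^h = ∑_{a ∈ F*} K₂(λ;a)^h` of 2-dimensional Kloosterman sums. -/
noncomputable def MK2 (F : Type) [Field F] [Fintype F] (r h : ℕ) : ℤ := by
  classical exact ∑ a ∈ Finset.univ.filter (fun a : F => a ≠ 0), (Klm F r 2 a) ^ h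

/-- The binary code `C(G) = {u ∈ 𝔽₂^G : ∑_{g ∈ G} u_g Tr(g) = 0 in F}`. -/
noncomputable def code (F : Type) [Field F] [Fintype F] [DecidableEq F]
    {ι : Type} [Fintype ι] [DecidableEq ι] (G : Finset (Matrix ι ι F)) :
    Finset (↥G → ZMod 2) := by
  classical
  exact Finset.univ.filter
    (fun u => ∑ g : ↥G, (u g).val • Matrix.trace (g : Matrix ι ι F) = 0)

/-- Number of codewords of Hamming weight `j` in the code `C(G)`. -/
noncomputable def wtCount (F : Type) [Field F] [Fintype F] [DecidableEq F]
    {ι : Type} [Fintype ι] [DecidableEq ι] (G : Finset (Matrix ι ι F)) (j : ℕ) : ℕ := by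
  classical
  exact ((code F G).filter
    (fun u => (Finset.univ.filter (fun g : ↥G => u g = 1)).card = j)).card

/-- `t! · S(h,t)` where `S(h,t)` is the Stirling number of the second kind,
`S(h,t) = (1/t!) ∑_{j=0}^{t} (−1)^{t−j} C(t,j) j^h`. -/
def tS (h t : ℕ) : ℤ :=
  ∑ j ∈ Finset.range (t + 1), (-1 : ℤ) ^ (t - j) * (t.choose j : ℤ) * (j : ℤ) ^ h

/-- Binomial coefficient with integer arguments: `0` whenever `k < 0` or `k > n`. -/
def ichoose (n k : ℤ) : ℤ := if 0 ≤ k ∧ k ≤ n then (n.toNat.choose k.toNat : ℤ) else 0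

lemma pow_eq_sum_tS_mul_choose (h w : ℕ) :
    (w : ℤ) ^ h = ∑ t ∈ range (h + 1), tS h t * (w.choose t : ℤ) := by
  have hd : ∀ t, (fwdDiff (1 : ℤ))^[t] (fun x : ℤ => x ^ h) 0 = tS h t := fun t => by
    rw [fwdDiff_iter_eq_sum_shift, tS]
    exact sum_congr rfl fun j _ => by simp
  have hw := shift_eq_sum_fwdDiff_iter (1 : ℤ) (fun x : ℤ => x ^ h) w 0
  simp only [hd, zero_add, nsmul_eq_mul, mul_one] at hw
  have hbig : ∀ t, h < t → tS h t = 0 := fun t ht => by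
    rw [← hd, fwdDiff_iter_pow_eq_zero_of_lt ht]
    rfl
  rw [hw]
  trans ∑ t ∈ range (max w h + 1), tS h t * (w.choose t : ℤ)
  · simp_rw [mul_comm (tS h _)]
    refine sum_subset (range_mono (by omega)) fun t _ ht => ?_
    rw [Nat.choose_eq_zero_of_lt (by simpa using ht)]
    simp
  · refine (sum_subset (range_mono (by omega)) fun t _ ht => ?_).symm
    rw [hbig t (by simpa using ht), zero_mul]

lemma card_powersetCard_filter_superset {ι : Type*} [Fintype ι] [DecidableEq ι] (S : Finset ι)
    {t : ℕ} (hS : S.card ≤ t) :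
    (((univ : Finset ι).powersetCard t).filter (S ⊆ ·)).card
      = (Fintype.card ι - S.card).choose (t - S.card) := by
  rw [← card_compl, ← card_powersetCard]
  refine card_nbij' (· \ S) (· ∪ S) ?_ ?_ ?_ ?_
  · intro T hT
    simp only [coe_filter, mem_powersetCard_univ, Set.mem_ofPred_eq] at hT
    simp only [mem_coe, mem_powersetCard, card_sdiff_of_subset hT.2, hT.1, and_true]
    intro x hx
    simpa using (mem_sdiff.1 hx).2
  · intro T hT
    simp only [mem_coe, mem_powersetCard] at hT
    have hd : Disjoint T S := disjoint_left.2 fun x hx => by simpa using hT.1 hx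
    simp only [coe_filter, mem_powersetCard_univ, Set.mem_ofPred_eq, subset_union_right, and_true]
    rw [card_union_of_disjoint hd, hT.2]
    omega
  · intro T hT
    simp only [coe_filter, Set.mem_ofPred_eq] at hT
    exact sdiff_union_of_subset hT.2
  · intro T hT
    simp only [mem_coe, mem_powersetCard] at hT
    have hd : Disjoint T S := disjoint_left.2 fun x hx => by simpa using hT.1 hx
    exact union_sdiff_cancel_right hd

lemma two_pow_mul_choose_card_neg {ι : Type*} [Fintype ι] [DecidableEq ι] (ε : ι → ℤ)
    (hε : ∀ i, ε i = 1 ∨ ε i = -1) (t : ℕ) :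
    (2 : ℤ) ^ t * (((univ.filter fun i => ε i = -1).card.choose t : ℕ) : ℤ)
      = ∑ S : Finset ι, if S.card ≤ t then (-1 : ℤ) ^ S.card *
          ((Fintype.card ι - S.card).choose (t - S.card) : ℤ) * ∏ i ∈ S, ε i else 0 := by
  have key : ∀ T ∈ (univ : Finset ι).powersetCard t, ∏ i ∈ T, (1 - ε i)
      = if T ⊆ univ.filter (fun i => ε i = -1) then (2 : ℤ) ^ t else 0 := by
    intro T hT
    split_ifs with hs
    · rw [← (mem_powersetCard.1 hT).2]
      refine prod_eq_pow_card fun i hi => ?_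
      rw [(mem_filter.1 (hs hi)).2]
      norm_num
    · obtain ⟨i, hi, hn⟩ := not_subset.1 hs
      refine prod_eq_zero hi ?_
      rcases hε i with h1 | h1
      · simp [h1]
      · simp [h1] at hn
  have hfilter : ((univ : Finset ι).powersetCard t).filter
      (· ⊆ univ.filter fun i => ε i = -1) = (univ.filter fun i => ε i = -1).powersetCard t := by
    ext T
    simp [mem_powersetCard, and_comm]
  trans ∑ T ∈ (univ : Finset ι).powersetCard t, ∏ i ∈ T, (1 - ε i)
  · rw [sum_congr rfl key, ← sum_filter, hfilter]
    simp [mul_comm]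
  · have hexp : ∀ T : Finset ι, ∏ i ∈ T, (1 - ε i)
        = ∑ S : Finset ι, if S ⊆ T then (-1 : ℤ) ^ S.card * ∏ i ∈ S, ε i else 0 := by
      intro T
      simp_rw [sub_eq_add_neg, prod_one_add, prod_neg]
      rw [← sum_filter]
      exact sum_congr (by ext; simp) fun _ _ => rfl
    simp_rw [hexp]
    rw [sum_comm]
    refine sum_congr rfl fun S _ => ?_
    rw [← sum_filter, sum_const, nsmul_eq_mul]
    split_ifs with hS
    · rw [card_powersetCard_filter_superset S hS]
      ring
    · rw [filter_eq_empty_iff.2]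
      · simp
      · intro T hT hST
        exact hS ((card_le_card hST).trans (mem_powersetCard.1 hT).2.le)

lemma ichoose_sub_sub {N j t : ℕ} (hjN : j ≤ N) (hjt : j ≤ t) :
    ichoose ((N : ℤ) - j) ((N : ℤ) - t) = ((N - j).choose (t - j) : ℤ) := by
  rw [ichoose]
  split_ifs with hc
  · have h1 : ((N : ℤ) - j).toNat = N - j := by omega
    have h2 : ((N : ℤ) - t).toNat = (N - j) - (t - j) := by omega
    rw [h1, h2, Nat.choose_symm (by omega)]
  · rw [Nat.choose_eq_zero_of_lt (by omega)]
    rfl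

/-- The Pless power moment identity for a family of sign vectors whose subset products are
orthogonal to the trivial one, except on the subsets satisfying `P`. -/
lemma sum_two_mul_card_neg_pow {κ ι : Type*} [Fintype κ] [Fintype ι] [DecidableEq ι]
    (ε : κ → ι → ℤ) (hε : ∀ a i, ε a i = 1 ∨ ε a i = -1) (P : Finset ι → Prop) [DecidablePred P]
    (q : ℤ) (hP : ∀ S, ∑ a, ∏ i ∈ S, ε a i = if P S then q else 0) (h : ℕ) :
    ∑ a, (2 * ((univ.filter fun i => ε a i = -1).card : ℤ)) ^ h
      = q * ∑ j ∈ range (min (Fintype.card ι) h + 1), (-1 : ℤ) ^ j *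
          ((univ.filter fun S : Finset ι => P S ∧ S.card = j).card : ℤ) *
            ∑ t ∈ Icc j h, tS h t * 2 ^ (h - t) *
              ichoose ((Fintype.card ι : ℤ) - j) ((Fintype.card ι : ℤ) - t) := by
  have hS : ∀ j ∈ range (min (Fintype.card ι) h + 1), (-1 : ℤ) ^ j *
      ((univ.filter fun S : Finset ι => P S ∧ S.card = j).card : ℤ) *
        ∑ t ∈ Icc j h, tS h t * 2 ^ (h - t) *
          ichoose ((Fintype.card ι : ℤ) - j) ((Fintype.card ι : ℤ) - t)
      = ∑ S : Finset ι, if S.card = j then (if P S then (-1 : ℤ) ^ S.card *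
          ∑ t ∈ Icc S.card h, tS h t * 2 ^ (h - t) *
            ((Fintype.card ι - S.card).choose (t - S.card) : ℤ) else 0) else 0 := by
    intro j hj
    rw [← sum_filter, ← sum_filter, filter_filter]
    simp_rw [and_comm (a := P _)]
    symm
    rw [sum_congr rfl (g := fun _ => (-1 : ℤ) ^ j * ∑ t ∈ Icc j h, tS h t * 2 ^ (h - t) *
          ichoose ((Fintype.card ι : ℤ) - j) ((Fintype.card ι : ℤ) - t))]
    · rw [sum_const, nsmul_eq_mul]
      ring
    · intro S hS
      obtain ⟨rfl, -⟩ := (mem_filter.1 hS).2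
      congr 1
      refine sum_congr rfl fun t ht => ?_
      rw [ichoose_sub_sub (card_le_univ S) (mem_Icc.1 ht).1]
  rw [sum_congr rfl hS, sum_comm]
  have hpt : ∀ a, (2 * ((univ.filter fun i => ε a i = -1).card : ℤ)) ^ h
      = ∑ S : Finset ι, (∑ t ∈ Icc S.card h, tS h t * 2 ^ (h - t) * ((-1 : ℤ) ^ S.card *
          ((Fintype.card ι - S.card).choose (t - S.card) : ℤ))) * ∏ i ∈ S, ε a i := by
    intro a
    rw [mul_pow, pow_eq_sum_tS_mul_choose, mul_sum]
    trans ∑ t ∈ range (h + 1), tS h t * 2 ^ (h - t) *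
        (2 ^ t * (((univ.filter fun i => ε a i = -1).card.choose t : ℕ) : ℤ))
    · refine sum_congr rfl fun t ht => ?_
      rw [← pow_sub_mul_pow (2 : ℤ) (Nat.lt_succ_iff.1 (mem_range.1 ht))]
      ring
    · simp_rw [two_pow_mul_choose_card_neg (ε a) (hε a), mul_sum]
      rw [sum_comm]
      refine sum_congr rfl fun S _ => ?_
      simp_rw [mul_ite, mul_zero]
      rw [← sum_filter, sum_mul]
      refine sum_congr (by ext t; simp; omega) fun t _ => by ring
  simp_rw [hpt]
  rw [sum_comm, mul_sum]
  refine sum_congr rfl fun S _ => ?_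
  rw [← mul_sum, hP, sum_ite_eq]
  by_cases hp : P S
  · simp only [hp, if_true]
    split_ifs with hc
    · rw [mul_comm, mul_sum (a := (-1 : ℤ) ^ S.card)]
      congr 1
      exact sum_congr rfl fun t _ => by ring
    · have hlt : h < S.card := by
        have := card_le_univ S
        simp at hc
        omega
      simp [Icc_eq_empty_of_lt hlt]
  · simp [hp]

section Trace

variable {F : Type} [Field F] {r : ℕ}

lemma trF_add [CharP F 2] (x y : F) : trF F r (x + y) = trF F r x + trF F r y := by
  simp [trF, add_pow_char_pow, sum_add_distrib]

lemma trF_eq_zero_or_one [Fintype F] [CharP F 2] (hF : Fintype.card F = 2 ^ r) (x : F) :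
    trF F r x = 0 ∨ trF F r x = 1 := by
  have hsq : trF F r x ^ 2 = trF F r x := by
    have h1 := sum_range_succ (fun i => x ^ 2 ^ i) r
    rw [sum_range_succ' (fun i => x ^ 2 ^ i) r, ← hF, FiniteField.pow_card, pow_zero,
      pow_one] at h1
    rw [trF, sum_pow_char, ← add_right_cancel h1]
    simp [pow_succ, pow_mul]
  rcases eq_or_ne (trF F r x) 0 with h0 | h0
  · exact Or.inl h0
  · exact Or.inr (mul_left_cancel₀ h0 (by rw [← sq, hsq, mul_one]))

lemma exists_trF_ne_zero [Fintype F] (hr : 0 < r) (hF : Fintype.card F = 2 ^ r) :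
    ∃ x : F, trF F r x ≠ 0 := by
  by_contra! h0
  set p : Polynomial F := ∑ i ∈ range r, Polynomial.X ^ 2 ^ i with hp
  have hcoeff : p.coeff 1 = 1 := by
    rw [hp, Polynomial.finsetSum_coeff, sum_eq_single 0]
    · simp
    · intro i _ hi
      rw [Polynomial.coeff_X_pow, if_neg]
      exact (Nat.one_lt_two_pow hi).ne
    · intro hn
      exact absurd (mem_range.2 hr) hn
  have hdeg : p.natDegree < 2 ^ r := by
    refine lt_of_le_of_lt (Polynomial.natDegree_sum_le_of_forall_le (n := 2 ^ (r - 1)) _ _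
      fun i hi => ?_) (Nat.pow_lt_pow_right (by norm_num) (by omega))
    rw [Polynomial.natDegree_X_pow]
    have := mem_range.1 hi
    exact Nat.pow_le_pow_right (by norm_num) (by omega)
  have hzero : p = 0 := by
    refine Polynomial.eq_zero_of_natDegree_lt_card_of_eval_eq_zero p (f := (id : F → F))
      Function.injective_id (fun x => ?_) (by rwa [hF])
    simpa [hp, Polynomial.eval_finsetSum, trF] using h0 x
  simp [hzero] at hcoeff

lemma lam_eq_one_or_neg_one (x : F) : lam F r x = 1 ∨ lam F r x = -1 := by
  unfold lam
  split_ifs <;> simp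

lemma lam_zero : lam F r 0 = 1 := by
  simp [lam, trF]

lemma lam_add [Fintype F] [CharP F 2] (hF : Fintype.card F = 2 ^ r) (x y : F) :
    lam F r (x + y) = lam F r x * lam F r y := by
  have h2 : (1 : F) + 1 = 0 := CharTwo.add_self_eq_zero 1
  rcases trF_eq_zero_or_one hF x with hx | hx <;> rcases trF_eq_zero_or_one hF y with hy | hy <;>
    simp [lam, trF_add, hx, hy, h2]

lemma lam_sum [Fintype F] [CharP F 2] (hF : Fintype.card F = 2 ^ r) {ι : Type*}
    (s : Finset ι) (f : ι → F) : lam F r (∑ i ∈ s, f i) = ∏ i ∈ s, lam F r (f i) := by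
  classical
  induction s using Finset.induction_on with
  | empty => simp [lam_zero]
  | insert i s hi ih => rw [sum_insert hi, prod_insert hi, lam_add hF, ih]

lemma sum_lam_mul [Fintype F] [DecidableEq F] [CharP F 2] (hr : 0 < r)
    (hF : Fintype.card F = 2 ^ r) (b : F) :
    ∑ a : F, lam F r (a * b) = if b = 0 then (2 : ℤ) ^ r else 0 := by
  split_ifs with hb
  · simp [hb, lam_zero, hF]
  · obtain ⟨x, hx⟩ := exists_trF_ne_zero hr hF
    have hshift : ∑ a : F, lam F r (a * b) = ∑ a : F, lam F r ((a + x * b⁻¹) * b) :=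
      (Equiv.sum_comp (Equiv.addRight (x * b⁻¹)) fun a => lam F r (a * b)).symm
    have hneg : ∀ a, lam F r ((a + x * b⁻¹) * b) = - lam F r (a * b) := fun a => by
      rw [add_mul, lam_add hF, inv_mul_cancel_right₀ hb]
      simp [lam, hx]
    simp_rw [hneg, sum_neg_distrib] at hshift
    omega

end Trace

section OrthogonalPlane

variable {F : Type} [Field F]

/-- The element `diag(α, α⁻¹)` of the orthogonal group of the hyperbolic plane. -/
def hyperbolicDiag (α : F) : Matrix (Fin 1 ⊕ Fin 1) (Fin 1 ⊕ Fin 1) F :=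
  diagonal (Sum.elim (fun _ => α) fun _ => α⁻¹)

lemma trace_hyperbolicDiag (α : F) : (hyperbolicDiag α).trace = α + α⁻¹ := by
  simp [hyperbolicDiag, trace_diagonal]

lemma hyperbolicDiag_injective : Function.Injective (hyperbolicDiag : F → _) := fun α β hαβ => by
  simpa [hyperbolicDiag] using congrFun (congrFun hαβ (Sum.inl 0)) (Sum.inl 0)

variable [Fintype F] [DecidableEq F]

lemma SOplusGrp_one : SOplusGrp F 1 = (univ.filter fun α : F => α ≠ 0).image hyperbolicDiag := by
  ext w
  simp only [SOplusGrp, OplusGrp, mem_filter, mem_univ, true_and, mem_image]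
  constructor
  · rintro ⟨⟨-, hw⟩, htr⟩
    have h1 := hw (Sum.elim (fun _ => 1) fun _ => 0)
    have h2 := hw (Sum.elim (fun _ => 0) fun _ => 1)
    have h3 := hw (Sum.elim (fun _ => 1) fun _ => 1)
    simp [thetaPlus, mulVec, dotProduct] at h1 h2 h3
    simp [trace, toBlocks₁₂, toBlocks₂₁, mul_apply] at htr
    generalize ha : w (Sum.inl 0) (Sum.inl 0) = a at *
    generalize hb : w (Sum.inl 0) (Sum.inr 0) = b at *
    generalize hc : w (Sum.inr 0) (Sum.inl 0) = c at *
    generalize hd : w (Sum.inr 0) (Sum.inr 0) = d at *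
    have had : a * d = 1 := by
      have hbc : b * c = 0 := by rcases htr with h | h <;> simp [h]
      have hac : a * c = 0 := by rcases h1 with h | h <;> simp [h]
      have hbd : b * d = 0 := by rcases h2 with h | h <;> simp [h]
      linear_combination h3 - hbc - hac - hbd
    have ha0 : a ≠ 0 := left_ne_zero_of_mul_eq_one had
    have hd0 : d ≠ 0 := right_ne_zero_of_mul_eq_one had
    refine ⟨a, ha0, ?_⟩
    ext i j
    rcases i with i | i <;> rcases j with j | j <;> fin_cases i <;> fin_cases j
    · simp [hyperbolicDiag, ha]
    · simp [hyperbolicDiag, hb, h2.resolve_right hd0]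
    · simp [hyperbolicDiag, hc, h1.resolve_left ha0]
    · simp [hyperbolicDiag, hd, eq_inv_of_mul_eq_one_right had]
  · rintro ⟨α, hα, rfl⟩
    refine ⟨⟨?_, fun x => ?_⟩, ?_⟩
    · rw [isUnit_iff_isUnit_det, hyperbolicDiag, det_diagonal]
      simp [hα]
    · simp [thetaPlus, hyperbolicDiag, mulVec_diagonal]
      field_simp
    · simp [trace, toBlocks₁₂, toBlocks₂₁, mul_apply, hyperbolicDiag]

lemma sum_SOplusGrp_one {M : Type*} [AddCommMonoid M] (f : F → M) :
    ∑ g : ↥(SOplusGrp F 1), f (g.1.trace)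
      = ∑ α ∈ univ.filter (fun α : F => α ≠ 0), f (α + α⁻¹) := by
  rw [sum_coe_sort (SOplusGrp F 1) fun g => f g.trace, SOplusGrp_one,
    sum_image hyperbolicDiag_injective.injOn]
  simp_rw [trace_hyperbolicDiag]

lemma card_filter_ne_zero : (univ.filter fun α : F => α ≠ 0).card = Fintype.card F - 1 := by
  rw [filter_ne', card_erase_of_mem (mem_univ _), card_univ]

lemma card_SOplusGrp_one : (SOplusGrp F 1).card = Fintype.card F - 1 := by
  rw [SOplusGrp_one, card_image_of_injective _ hyperbolicDiag_injective, card_filter_ne_zero]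

end OrthogonalPlane

lemma wtCount_eq_card_zero_sum {F : Type} [Field F] [Fintype F] [DecidableEq F]
    {ι : Type} [Fintype ι] [DecidableEq ι] (G : Finset (Matrix ι ι F)) (j : ℕ) :
    wtCount F G j = (univ.filter fun S : Finset ↥G =>
      ∑ g ∈ S, trace (g : Matrix ι ι F) = 0 ∧ S.card = j).card := by
  classical
  have hval : ∀ x : ZMod 2, x.val = if x = 1 then 1 else 0 := by decide
  have hsum : ∀ u : ↥G → ZMod 2, ∑ g : ↥G, (u g).val • trace (g : Matrix ι ι F)
      = ∑ g ∈ univ.filter (fun g => u g = 1), trace (g : Matrix ι ι F) := fun u => by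
    rw [sum_filter]
    refine sum_congr rfl fun g _ => ?_
    rw [hval]
    split_ifs <;> simp
  have hone : ∀ x : ZMod 2, (if x = 1 then (1 : ZMod 2) else 0) = x := by decide
  rw [wtCount, code, filter_filter]
  have hsupp : ∀ S : Finset ↥G,
      univ.filter (fun g => (if g ∈ S then (1 : ZMod 2) else 0) = 1) = S := fun S => by
    ext g
    simp
  refine card_nbij' (fun u => univ.filter fun g => u g = 1) (fun S g => if g ∈ S then 1 else 0)
    ?_ ?_ ?_ ?_
  · intro u hu
    simp only [coe_filter, hsum, mem_univ, true_and, Set.mem_ofPred_eq] at hu ⊢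
    exact hu
  · intro S hS
    simp only [coe_filter, hsum, mem_univ, true_and, Set.mem_ofPred_eq] at hS ⊢
    rwa [hsupp]
  · intro u _
    funext g
    simpa using hone (u g)
  · intro S _
    exact hsupp S

lemma Kl_sq {F : Type} [Field F] [Fintype F] [DecidableEq F] (r : ℕ) {a : F} (ha : a ≠ 0) :
    Kl F r (a ^ 2) = ∑ g : ↥(SOplusGrp F 1), lam F r (a * g.1.trace) := by
  rw [sum_SOplusGrp_one fun x => lam F r (a * x), Kl]
  symm
  refine sum_nbij' (a * ·) (a⁻¹ * ·) ?_ ?_ ?_ ?_ ?_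
  · intro α hα
    simpa [ha] using hα
  · intro α hα
    simpa [ha] using hα
  · intro α _
    exact inv_mul_cancel_left₀ ha α
  · intro α _
    exact mul_inv_cancel_left₀ ha α
  · intro α hα
    have : α ≠ 0 := by simpa using hα
    congr 1
    field_simp

lemma card_sub_sum_sign {ι : Type*} [Fintype ι] (ε : ι → ℤ) (hε : ∀ i, ε i = 1 ∨ ε i = -1) :
    (Fintype.card ι : ℤ) - ∑ i, ε i = 2 * ((univ.filter fun i => ε i = -1).card : ℤ) := by
  have h1 : (Fintype.card ι : ℤ) = ∑ _i : ι, (1 : ℤ) := by simp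
  rw [h1, ← sum_sub_distrib, card_filter, Nat.cast_sum, mul_sum]
  refine sum_congr rfl fun i _ => ?_
  rcases hε i with h | h <;> simp [h]

lemma sum_sub_Kl_pow {F : Type} [Field F] [Fintype F] [DecidableEq F] {r : ℕ} (hr : 0 < r)
    (hF : Fintype.card F = 2 ^ r) {h : ℕ} (hh : 1 ≤ h) :
    ∑ a ∈ univ.filter (fun a : F => a ≠ 0), (((2 : ℤ) ^ r - 1) - Kl F r a) ^ h
      = (2 : ℤ) ^ r * ∑ j ∈ range (min (2 ^ r - 1) h + 1), (-1 : ℤ) ^ j *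
          (wtCount F (SOplusGrp F 1) j : ℤ) *
            ∑ t ∈ Icc j h, tS h t * 2 ^ (h - t) *
              ichoose (((2 ^ r - 1 : ℕ) : ℤ) - j) (((2 ^ r - 1 : ℕ) : ℤ) - t) := by
  have : Fact (Nat.Prime 2) := ⟨Nat.prime_two⟩
  have : CharP F 2 := charP_of_card_eq_prime_pow hF
  have hcard : Fintype.card ↥(SOplusGrp F 1) = 2 ^ r - 1 := by
    rw [Fintype.card_coe, card_SOplusGrp_one, hF]
  have hcardZ : (Fintype.card ↥(SOplusGrp F 1) : ℤ) = (2 : ℤ) ^ r - 1 := by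
    simp [hcard]
  have pless := sum_two_mul_card_neg_pow
    (fun (a : F) (g : ↥(SOplusGrp F 1)) => lam F r (a * g.1.trace))
    (fun _ _ => lam_eq_one_or_neg_one _)
    (fun S => ∑ g ∈ S, g.1.trace = 0) (2 ^ r)
    (fun S => by simp_rw [← lam_sum hF, ← mul_sum, sum_lam_mul hr hF]) h
  simp_rw [← wtCount_eq_card_zero_sum, hcard] at pless
  rw [← pless, ← hcardZ]
  trans ∑ a ∈ univ.filter (fun a : F => a ≠ 0),
      ((Fintype.card ↥(SOplusGrp F 1) : ℤ) - Kl F r (a ^ 2)) ^ h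
  · symm
    refine sum_nbij (· ^ 2) ?_ (frobenius_inj F 2).injOn ?_ fun _ _ => rfl
    · intro a ha
      simpa using ha
    · intro b hb
      obtain ⟨a, rfl⟩ := surjective_frobenius F 2 b
      refine ⟨a, ?_, rfl⟩
      simpa [frobenius_def] using hb
  · rw [← sum_subset (filter_subset (fun a : F => a ≠ 0) univ)]
    · refine sum_congr rfl fun a ha => ?_
      rw [Kl_sq r (mem_filter.1 ha).2, card_sub_sum_sign _ fun _ => lam_eq_one_or_neg_one _]
    · intro a _ ha
      obtain rfl : a = 0 := by simpa using ha
      simp [lam_zero, Nat.one_le_iff_ne_zero.1 hh]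

theorem stmt0 (r : ℕ) (hr : 3 ≤ r) (F : Type) [Field F] [Fintype F] [DecidableEq F]
    (hF : Fintype.card F = 2 ^ r) (N₁ : ℕ) (hN₁ : N₁ = 2 ^ r - 1)
    (h : ℕ) (hh : 1 ≤ h) :
    (SOplusGrp F 1).card = N₁ ∧
    MK F r h =
      (∑ l ∈ Finset.range h,
        (-1 : ℤ) ^ (h + l + 1) * (h.choose l : ℤ) * ((2 ^ r : ℤ) - 1) ^ (h - l) * MK F r l) +
      (2 ^ r : ℤ) *
        ∑ j ∈ Finset.range (min N₁ h + 1),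
          (-1 : ℤ) ^ (h + j) * (wtCount F (SOplusGrp F 1) j : ℤ) *
            ∑ t ∈ Finset.Icc j h,
              tS h t * 2 ^ (h - t) * ichoose ((N₁ : ℤ) - (j : ℤ)) ((N₁ : ℤ) - (t : ℤ)) := by
  have hcast : (N₁ : ℤ) = (2 : ℤ) ^ r - 1 := by simp [hN₁]
  refine ⟨by rw [card_SOplusGrp_one, hF, hN₁], ?_⟩
  have hmoment := sum_sub_Kl_pow (by omega) hF hh
  rw [← hN₁, ← hcast] at hmoment
  have hexp : (-1 : ℤ) ^ h * ∑ a ∈ univ.filter (fun a : F => a ≠ 0), ((N₁ : ℤ) - Kl F r a) ^ h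
      = ∑ l ∈ range (h + 1), (-1 : ℤ) ^ (h + l) * (h.choose l : ℤ) * (N₁ : ℤ) ^ (h - l)
          * MK F r l := by
    have hMK : ∀ l, MK F r l = ∑ a ∈ univ.filter (fun a : F => a ≠ 0), Kl F r a ^ l := fun l => by
      rw [MK]
      congr!
    simp_rw [hMK, mul_sum]
    rw [sum_comm]
    refine sum_congr rfl fun a _ => ?_
    rw [sub_eq_neg_add, add_pow, mul_sum]
    refine sum_congr rfl fun l _ => ?_
    rw [neg_pow, pow_add]
    ring
  rw [sum_range_succ, hmoment, ← two_mul, Even.neg_one_pow (even_two_mul h)] at hexp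
  simp only [Nat.choose_self, Nat.sub_self, pow_zero, Nat.cast_one, one_mul] at hexp
  rw [← hcast]
  have hneg : ∑ l ∈ range h, (-1 : ℤ) ^ (h + l + 1) * (h.choose l : ℤ) * (N₁ : ℤ) ^ (h - l)
      * MK F r l = -∑ l ∈ range h, (-1 : ℤ) ^ (h + l) * (h.choose l : ℤ) * (N₁ : ℤ) ^ (h - l)
          * MK F r l := by
    rw [← sum_neg_distrib]
    exact sum_congr rfl fun l _ => by ring
  simp_rw [pow_add (-1 : ℤ) h, mul_assoc, ← mul_sum] at hexp hneg ⊢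
  linarith
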